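/- arXiv:2411.04716 — 3 statements merged into one kernel-verified Lean document; each statement's English description precedes it below -/
import Mathlib

section
/- Let M be a countable set, G ≤ Sym(M) a permutation group, and A ⊆ M a finite subset. Consider the unitary action of G on ℓ²(M) given by (g·f)(x) = f(g⁻¹·x). Then the closure in ℓ²(M) of the set {f ∈ ℓ²(M) : the orbit G_A·f is finite} equals {f ∈ ℓ²(M) : f(b) = 0 for all b ∉ acl A}, i.e., the subspace of functions supported on acl A. -/
open Pointwise

/-- The setwise stabilizer of `A` in the permutation group `G ≤ Sym(M)`, as a set of
permutations. -/
def setwiseStab {M : Type*} (G : Subgroup (Equiv.Perm M)) (A : Set M) :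
    Set (Equiv.Perm M) :=
  {g : Equiv.Perm M | g ∈ G ∧ g • A = A}

/-- The algebraic closure of `A`: points whose orbit under the setwise stabilizer of `A`
is finite. -/
def aclP {M : Type*} (G : Subgroup (Equiv.Perm M)) (A : Set M) : Set M :=
  {b : M | {c : M | ∃ g ∈ setwiseStab G A, g b = c}.Finite}

/-- The orbit of `f ∈ ℓ²(M)` under the setwise stabilizer of `A`, acting by
`(g • f)(x) = f (g⁻¹ x)`. -/
def stabOrbit {M : Type*} (G : Subgroup (Equiv.Perm M)) (A : Set M)
    (f : lp (fun _ : M => ℂ) 2) : Set (lp (fun _ : M => ℂ) 2) :=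
  {f' : lp (fun _ : M => ℂ) 2 | ∃ g ∈ setwiseStab G A,
    ∀ x : M, (f' : ∀ _ : M, ℂ) x = (f : ∀ _ : M, ℂ) (g⁻¹ x)}

/-- A vector of `ℓ²` takes each nonzero value only finitely often. -/
theorem lp_two_finite_fiber {M : Type*} (f : lp (fun _ : M => ℂ) 2) {c : ℂ} (hc : c ≠ 0) :
    {x : M | (f : ∀ _ : M, ℂ) x = c}.Finite := by
  have hs : Summable fun x => ‖(f : ∀ _ : M, ℂ) x‖ ^ (2 : ENNReal).toReal :=
    (lp.memℓp f).summable (by norm_num)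
  have hpos : 0 < ‖c‖ ^ (2 : ENNReal).toReal := Real.rpow_pos_of_pos (norm_pos_iff.2 hc) _
  have hev := hs.tendsto_cofinite_zero.eventually (gt_mem_nhds hpos)
  refine (Filter.eventually_cofinite.1 hev).subset ?_
  rintro x rfl
  exact lt_irrefl _

/-- The translate of an `ℓ²` vector by a permutation is again in `ℓ²`. -/
theorem exists_lp_two_translate {M : Type*} (f : lp (fun _ : M => ℂ) 2) (g : Equiv.Perm M) :
    ∃ f' : lp (fun _ : M => ℂ) 2,
      ∀ x : M, (f' : ∀ _ : M, ℂ) x = (f : ∀ _ : M, ℂ) (g⁻¹ x) := by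
  have hs : Summable fun x => ‖(f : ∀ _ : M, ℂ) x‖ ^ (2 : ENNReal).toReal :=
    (lp.memℓp f).summable (by norm_num)
  exact ⟨⟨fun x => (f : ∀ _ : M, ℂ) (g⁻¹ x),
    memℓp_gen ((Equiv.summable_iff g⁻¹).2 hs)⟩, fun _ => rfl⟩

/-- A vector with finite orbit under the stabilizer of `A` vanishes off the algebraic closure
of `A`. -/
theorem eq_zero_of_finite_stabOrbit {M : Type*} {G : Subgroup (Equiv.Perm M)} {A : Set M}
    {f : lp (fun _ : M => ℂ) 2} (hf : (stabOrbit G A f).Finite) {b : M} (hb : b ∉ aclP G A) :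
    (f : ∀ _ : M, ℂ) b = 0 := by
  by_contra h
  refine hb ((hf.biUnion fun f' _ => lp_two_finite_fiber f' h).subset ?_)
  rintro _ ⟨g, hg, rfl⟩
  obtain ⟨f', hf'⟩ := exists_lp_two_translate f g
  exact Set.mem_biUnion (⟨g, hg, hf'⟩ : f' ∈ stabOrbit G A f) (by simp [hf'])

/-- A vector supported on a finite subset of the algebraic closure of `A` has finite orbit under
the stabilizer of `A`. -/
theorem finite_stabOrbit_of_support_subset {M : Type*} {G : Subgroup (Equiv.Perm M)} {A : Set M}
    {f : lp (fun _ : M => ℂ) 2} {s : Set M} (hs : s.Finite) (hsA : s ⊆ aclP G A)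
    (hf : ∀ x ∉ s, (f : ∀ _ : M, ℂ) x = 0) : (stabOrbit G A f).Finite := by
  have hF : (⋃ b ∈ s, {c : M | ∃ g ∈ setwiseStab G A, g b = c}).Finite :=
    hs.biUnion fun b hb => hsA hb
  have hV : (Set.range (f : ∀ _ : M, ℂ)).Finite := by
    refine ((hs.image (f : ∀ _ : M, ℂ)).insert 0).subset ?_
    rintro _ ⟨x, rfl⟩
    by_cases hx : x ∈ s
    · exact Or.inr ⟨x, hx, rfl⟩
    · exact Or.inl (hf x hx)
  set F := ⋃ b ∈ s, {c : M | ∃ g ∈ setwiseStab G A, g b = c}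
  have hvanish : ∀ f' ∈ stabOrbit G A f, ∀ x ∉ F, (f' : ∀ _ : M, ℂ) x = 0 := by
    rintro f' ⟨g, hg, hf'⟩ x hx
    rw [hf']
    refine hf _ fun hmem => hx ?_
    exact Set.mem_biUnion hmem ⟨g, hg, by simp⟩
  have := hF.to_subtype
  refine Set.Finite.of_injOn (f := fun (f' : lp (fun _ : M => ℂ) 2) (x : F) => (f' : ∀ _ : M, ℂ) x)
    (s := stabOrbit G A f)
    (t := Set.univ.pi fun _ : F => Set.range (f : ∀ _ : M, ℂ)) ?_ ?_ (Set.Finite.pi fun _ => hV)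
  · rintro f' ⟨g, -, hf'⟩ x -
    exact ⟨g⁻¹ x, (hf' x).symm⟩
  · intro f₁ h₁ f₂ h₂ h
    ext x
    by_cases hx : x ∈ F
    · exact congrFun h ⟨x, hx⟩
    · rw [hvanish f₁ h₁ x hx, hvanish f₂ h₂ x hx]

/-- the closure in `ℓ²(M)` of the set of vectors with finite `G_A`-orbit is
exactly the subspace of functions supported on `acl A`. -/
theorem closure_finite_orbit_vectors_eq_supported_on_acl
    {M : Type*} [Countable M] (G : Subgroup (Equiv.Perm M)) (A : Set M) (hA : A.Finite) :
    closure {f : lp (fun _ : M => ℂ) 2 | (stabOrbit G A f).Finite}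
      = {f : lp (fun _ : M => ℂ) 2 | ∀ b : M, b ∉ aclP G A → (f : ∀ _ : M, ℂ) b = 0} := by
  classical
  apply Set.Subset.antisymm
  · refine closure_minimal (fun f hf b hb => eq_zero_of_finite_stabOrbit hf hb) ?_
    simp only [Set.ofPred_forall]
    refine isClosed_iInter fun b => isClosed_iInter fun _ => isClosed_eq ?_ continuous_const
    exact (continuous_apply b).comp (lp.uniformContinuous_coe (p := 2)).continuous
  · intro f hf
    refine mem_closure_of_tendsto (lp.hasSum_single (by norm_num) f)
      (Filter.Eventually.of_forall fun s => ?_)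
    refine finite_stabOrbit_of_support_subset (s := {x | x ∈ s ∧ x ∈ aclP G A})
      (s.finite_toSet.subset fun x hx => hx.1) (fun x hx => hx.2) fun x hx => ?_
    rw [lp.coeFn_sum, Finset.sum_apply]
    refine Finset.sum_eq_zero fun i hi => ?_
    rw [lp.single_apply]
    rcases eq_or_ne x i with rfl | hne
    · simpa using hf x fun h => hx ⟨hi, h⟩
    · exact Pi.single_eq_of_ne hne _
end

section
/- Let M be a countable set and G ≤ Sym(M) a permutation group such that for every a ∈ M, all orbits of the stabilizer G_a on M ∖ {a} are infinite. Let Z = [0,1], let Ω = Z^M carry the product σ-algebra and the shift action (g·ω)(a) = ω(g⁻¹·a), and let μ be a G-invariant Borel probability measure on Ω. Then the family of coordinate σ-fields (σ(ξ_a))_{a∈M} is conditionally independent, under μ, given the tail σ-field T₀. -/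
open MeasureTheory ProbabilityTheory

/-- The shift action of a permutation `g` of `M` on configurations `ω : M → [0,1]`:
`(g · ω)(a) = ω (g⁻¹ a)`. -/
def shiftAct {M : Type*} (g : Equiv.Perm M) (ω : M → unitInterval) : M → unitInterval :=
  fun a => ω (g⁻¹ a)

/-- The σ-field generated by the coordinate projection `ξ_a`. -/
def coordField {M : Type*} (a : M) : MeasurableSpace (M → unitInterval) :=
  MeasurableSpace.comap (fun ω => ω a) inferInstance

/-- The tail σ-field `T₀ = ⋂ {σ(ξ_a : a ∉ A) : A finite}`. -/
def tailField (M : Type*) : MeasurableSpace (M → unitInterval) :=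
  ⨅ A : Finset M, ⨆ (a : M) (_ : a ∉ A), coordField a

lemma tailField_le (M : Type*) :
    tailField M ≤ (inferInstance : MeasurableSpace (M → unitInterval)) := by
  refine le_trans (iInf_le _ (∅ : Finset M)) ?_
  exact iSup_le fun a => iSup_le fun _ => measurable_iff_comap_le.mp (measurable_pi_apply a)

open scoped Pointwise in
/-- **B. H. Neumann's separation lemma**: if a group acts with infinite orbits on the points of a
finite set `A`, then some group element moves `A` off a given finite set `B`. -/
theorem MulAction.exists_smul_notMem_of_infinite_orbit {H X : Type*} [Group H] [MulAction H X]
    {A B : Set X} (hA : A.Finite) (hB : B.Finite)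
    (horb : ∀ x ∈ A, (MulAction.orbit H x).Infinite) :
    ∃ h : H, ∀ x ∈ A, h • x ∉ B := by
  classical
  by_contra! hcon
  let s : Finset (X × X) :=
    (hA.toFinset ×ˢ hB.toFinset).filter fun p => ∃ h : H, h • p.1 = p.2
  have hs : ∀ p : X × X, ∃ k : H, p ∈ s → k • p.1 = p.2 := fun p => by
    by_cases hp : p ∈ s
    · obtain ⟨k, hk⟩ := (Finset.mem_filter.mp hp).2
      exact ⟨k, fun _ => hk⟩
    · exact ⟨1, fun h => absurd h hp⟩
  choose k hk using hs
  have hcover : ⋃ p ∈ s, k p • (MulAction.stabilizer H p.1 : Set H) = Set.univ := by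
    refine Set.eq_univ_of_forall fun h => ?_
    obtain ⟨x, hx, hxB⟩ := hcon h
    have hp : (x, h • x) ∈ s := by simp [s, hx, hxB]
    refine Set.mem_iUnion₂.mpr ⟨_, hp, ?_⟩
    rw [Set.mem_smul_set_iff_inv_smul_mem, SetLike.mem_coe, MulAction.mem_stabilizer_iff,
      smul_eq_mul, mul_smul, inv_smul_eq_iff]
    exact (hk _ hp).symm
  obtain ⟨p, hp, hfin⟩ := Subgroup.exists_finiteIndex_of_leftCoset_cover hcover
  have hpA : p.1 ∈ A := by
    simp only [s, Finset.mem_filter, Finset.mem_product, Set.Finite.mem_toFinset] at hp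
    exact hp.1.1
  refine hfin.index_ne_zero ?_
  rw [MulAction.index_stabilizer]
  exact (horb _ hpA).ncard

section CondExp

variable {Ω : Type*}

/-- Pythagoras for nested conditional expectations. -/
theorem integral_sq_condExp_sub_condExp {m₁ m₂ mΩ : MeasurableSpace Ω}
    {μ : Measure Ω} [IsFiniteMeasure μ]
    (h₁₂ : m₁ ≤ m₂) (h₂ : m₂ ≤ mΩ) {f : Ω → ℝ} (hf : MemLp f 2 μ) :
    ∫ ω, (μ[f | m₂] ω - μ[f | m₁] ω) ^ 2 ∂μ
      = ∫ ω, μ[f | m₂] ω ^ 2 ∂μ - ∫ ω, μ[f | m₁] ω ^ 2 ∂μ := by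
  have hg : MemLp (μ[f | m₂]) 2 μ := hf.condExp one_le_two
  have hh : MemLp (μ[f | m₁]) 2 μ := hf.condExp one_le_two
  have hgh : Integrable (μ[f | m₂] * μ[f | m₁]) μ := hg.integrable_mul hh
  have hcross : ∫ ω, μ[f | m₂] ω * μ[f | m₁] ω ∂μ = ∫ ω, μ[f | m₁] ω ^ 2 ∂μ := by
    rw [← integral_condExp (h₁₂.trans h₂) (f := fun ω => μ[f | m₂] ω * μ[f | m₁] ω)]
    refine integral_congr_ae ?_
    filter_upwards [condExp_mul_of_stronglyMeasurable_right (m := m₁)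
      stronglyMeasurable_condExp hgh integrable_condExp,
      condExp_condExp_of_le (f := f) (μ := μ) h₁₂ h₂] with ω h h'
    refine h.trans ?_
    rw [Pi.mul_apply, h', sq]
  have hexp : ∀ ω, (μ[f | m₂] ω - μ[f | m₁] ω) ^ 2
      = μ[f | m₂] ω ^ 2 - 2 * (μ[f | m₂] ω * μ[f | m₁] ω) + μ[f | m₁] ω ^ 2 := fun ω => by ring
  simp_rw [hexp]
  have hgh' : Integrable (fun ω => 2 * (μ[f | m₂] ω * μ[f | m₁] ω)) μ := hgh.const_mul 2
  rw [integral_add (f := fun ω => μ[f | m₂] ω ^ 2 - 2 * (μ[f | m₂] ω * μ[f | m₁] ω))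
    (hg.integrable_sq.sub hgh') hh.integrable_sq,
    integral_sub hg.integrable_sq hgh', integral_const_mul, hcross]
  ring

theorem integral_sq_condExp_mono {m₁ m₂ mΩ : MeasurableSpace Ω}
    {μ : Measure Ω} [IsFiniteMeasure μ]
    (h₁₂ : m₁ ≤ m₂) (h₂ : m₂ ≤ mΩ) {f : Ω → ℝ} (hf : MemLp f 2 μ) :
    ∫ ω, μ[f | m₁] ω ^ 2 ∂μ ≤ ∫ ω, μ[f | m₂] ω ^ 2 ∂μ := by
  have := integral_sq_condExp_sub_condExp h₁₂ h₂ hf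
  have : 0 ≤ ∫ ω, (μ[f | m₂] ω - μ[f | m₁] ω) ^ 2 ∂μ := integral_nonneg fun ω => sq_nonneg _
  linarith

theorem condExp_ae_eq_of_integral_sq_le {m₁ m₂ mΩ : MeasurableSpace Ω}
    {μ : Measure Ω} [IsFiniteMeasure μ]
    (h₁₂ : m₁ ≤ m₂) (h₂ : m₂ ≤ mΩ) {f : Ω → ℝ} (hf : MemLp f 2 μ)
    (hle : ∫ ω, μ[f | m₂] ω ^ 2 ∂μ ≤ ∫ ω, μ[f | m₁] ω ^ 2 ∂μ) :
    μ[f | m₂] =ᵐ[μ] μ[f | m₁] := by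
  have hpyth := integral_sq_condExp_sub_condExp h₁₂ h₂ hf
  have hnonneg : 0 ≤ ∫ ω, (μ[f | m₂] ω - μ[f | m₁] ω) ^ 2 ∂μ :=
    integral_nonneg fun ω => sq_nonneg _
  have hint : Integrable (fun ω => (μ[f | m₂] ω - μ[f | m₁] ω) ^ 2) μ :=
    ((hf.condExp one_le_two).sub (hf.condExp one_le_two)).integrable_sq
  have hzero := (integral_eq_zero_iff_of_nonneg (fun ω => sq_nonneg _) hint).mp (by linarith)
  filter_upwards [hzero] with ω hω
  exact sub_eq_zero.mp (pow_eq_zero_iff two_ne_zero |>.mp hω)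

/-- Conditional expectations commute with measure-preserving maps. -/
theorem MeasureTheory.MeasurePreserving.condExp_comp_ae_eq {Ω' : Type*}
    {mΩ : MeasurableSpace Ω} {m mΩ' : MeasurableSpace Ω'} {μ : Measure Ω} {ν : Measure Ω'}
    [IsFiniteMeasure μ] [IsFiniteMeasure ν] {T : Ω → Ω'} (hT : MeasurePreserving T μ ν)
    (hm : m ≤ mΩ') {f : Ω' → ℝ} (hf : Integrable f ν) :
    ν[f | m] ∘ T =ᵐ[μ] μ[f ∘ T | m.comap T] := by
  have hmT : m.comap T ≤ mΩ :=
    (MeasurableSpace.comap_mono hm).trans hT.measurable.comap_le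
  refine ae_eq_condExp_of_forall_setIntegral_eq hmT (hT.integrable_comp_of_integrable hf)
    (fun s _ _ => (hT.integrable_comp_of_integrable integrable_condExp).integrableOn) ?_ ?_
  · rintro _ ⟨s, hs, rfl⟩ -
    have hset : ∀ g : Ω' → ℝ, Integrable g ν →
        ∫ ω in T ⁻¹' s, (g ∘ T) ω ∂μ = ∫ ω in s, g ω ∂ν := fun g hg => by
      rw [← hT.map_eq, setIntegral_map (hm s hs) (hT.map_eq ▸ hg.aestronglyMeasurable)
        hT.aemeasurable]
      rfl
    rw [hset _ integrable_condExp, hset _ hf, setIntegral_condExp hm hf hs]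
  · exact (stronglyMeasurable_condExp.comp_measurable
      (comap_measurable T)).aestronglyMeasurable

theorem MeasureTheory.MeasurePreserving.integral_sq_condExp_comap
    {m mΩ : MeasurableSpace Ω} {μ : Measure Ω} [IsFiniteMeasure μ]
    {T : Ω → Ω} (hT : MeasurePreserving T μ μ) (hm : m ≤ mΩ)
    {f : Ω → ℝ} (hf : Integrable f μ) (hfT : f ∘ T = f) :
    ∫ ω, μ[f | m.comap T] ω ^ 2 ∂μ = ∫ ω, μ[f | m] ω ^ 2 ∂μ := by
  have h := hT.condExp_comp_ae_eq hm hf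
  rw [hfT] at h
  calc ∫ ω, μ[f | m.comap T] ω ^ 2 ∂μ = ∫ ω, μ[f | m] (T ω) ^ 2 ∂μ :=
        integral_congr_ae (h.symm.fun_comp (· ^ 2))
    _ = ∫ ω, μ[f | m] ω ^ 2 ∂μ := by
        have hmeas : AEStronglyMeasurable (fun ω => μ[f | m] ω ^ 2) (μ.map T) := by
          rw [hT.map_eq]
          exact ((stronglyMeasurable_condExp.mono hm).pow 2).aestronglyMeasurable
        rw [← integral_map hT.aemeasurable hmeas, hT.map_eq]

theorem tendsto_integral_sq_condExp {mΩ : MeasurableSpace Ω} {μ : Measure Ω} [IsFiniteMeasure μ]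
    (ℱ : Filtration ℕ mΩ) {f : Ω → ℝ} {R : ℝ} (hf : ∀ᵐ ω ∂μ, |f ω| ≤ R) :
    Filter.Tendsto (fun n => ∫ ω, μ[f | ℱ n] ω ^ 2 ∂μ) Filter.atTop
      (nhds (∫ ω, μ[f | ⨆ n, ℱ n] ω ^ 2 ∂μ)) := by
  refine tendsto_integral_of_dominated_convergence (fun _ => R ^ 2)
    (fun n => ((stronglyMeasurable_condExp.mono (ℱ.le n)).pow 2).aestronglyMeasurable)
    (integrable_const _) (fun n => ?_) ?_
  · filter_upwards [ae_bdd_abs_condExp_of_ae_bdd_abs (m := ℱ n) (μ := μ) (f := f) hf] with ω hω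
    rw [norm_pow, Real.norm_eq_abs]
    gcongr
  · filter_upwards [tendsto_ae_condExp (μ := μ) (ℱ := ℱ) f] with ω hω
    exact hω.pow 2

/-- A real function which is a.e. measurable for each term of a decreasing sequence of σ-fields is
a.e. measurable for their intersection. -/
theorem aestronglyMeasurable_iInf_of_antitone {m : ℕ → MeasurableSpace Ω}
    {mΩ : MeasurableSpace Ω} {μ : Measure Ω} (hm : Antitone m) {f : Ω → ℝ}
    (hf : ∀ n, AEStronglyMeasurable[m n] f μ) :
    AEStronglyMeasurable[iInf m] f μ := by
  let g : ℕ → Ω → ℝ := fun n => (hf n).mk f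
  refine ⟨fun ω => Filter.limsup (fun n => g n ω) Filter.atTop, ?_, ?_⟩
  · refine Measurable.stronglyMeasurable ?_
    intro s hs
    refine MeasurableSpace.measurableSet_iInf.mpr fun k => ?_
    have hlim : (fun ω => Filter.limsup (fun n => g n ω) Filter.atTop)
        = fun ω => Filter.limsup (fun n => g (n + k) ω) Filter.atTop := by
      funext ω
      exact (Filter.limsup_nat_add (fun n => g n ω) k).symm
    rw [hlim]
    refine Measurable.limsup (fun n => ?_) hs
    exact ((hf (n + k)).stronglyMeasurable_mk.mono (hm (Nat.le_add_left k n))).measurable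
  · filter_upwards [ae_all_iff.mpr fun n => (hf n).ae_eq_mk] with ω hω
    have : (fun n => g n ω) = fun _ => f ω := funext fun n => (hω n).symm
    simp [this]

/-- If, for each member of a family of σ-fields, conditioning its events on a σ-field containing
all the other members amounts to conditioning on `m'`, then the family is conditionally independent
given `m'`. -/
theorem iCondIndep_of_condExp_ae_eq {ι : Type*} {m' mΩ : MeasurableSpace Ω}
    {μ : Measure Ω} [StandardBorelSpace Ω] [IsFiniteMeasure μ] (hm' : m' ≤ mΩ)
    {m : ι → MeasurableSpace Ω} (hm : ∀ i, m i ≤ mΩ) {n : ι → MeasurableSpace Ω} (hn : ∀ i, n i ≤ mΩ) (hm'n : ∀ i, m' ≤ n i)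
    (hmn : ∀ i j, j ≠ i → m j ≤ n i)
    (h : ∀ i s, MeasurableSet[m i] s → μ⟦s | n i⟧ =ᵐ[μ] μ⟦s | m'⟧) :
    iCondIndep m' hm' m μ := by
  classical
  refine (iCondIndep_iff m' hm' m hm μ).mpr fun s f hf => ?_
  induction s using Finset.induction_on with
  | empty =>
    simp [condExp_const hm']
    rfl
  | insert i s hi ih =>
    have hfi : MeasurableSet[m i] (f i) := hf i (Finset.mem_insert_self i s)
    have hfs : ∀ j ∈ s, MeasurableSet[m j] (f j) := fun j hj => hf j (Finset.mem_insert_of_mem hj)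
    have hrest : MeasurableSet[n i] (⋂ j ∈ s, f j) :=
      Finset.measurableSet_biInter s fun j hj =>
        hmn i j (fun hji => hi (hji ▸ hj)) _ (hfs j hj)
    have hint : ∀ t : Set Ω, MeasurableSet t → Integrable (t.indicator fun _ => (1 : ℝ)) μ :=
      fun t ht => (integrable_const _).indicator ht
    set F : Ω → ℝ := (f i).indicator fun _ => 1
    set K : Ω → ℝ := (⋂ j ∈ s, f j).indicator fun _ => 1
    have hF : Integrable F μ := hint _ (hm i _ hfi)
    have hK : Integrable K μ := hint _ (hn i _ hrest)
    have hKm : StronglyMeasurable[n i] K := stronglyMeasurable_const.indicator hrest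
    have hsplit : ((⋂ j ∈ insert i s, f j).indicator fun _ => (1 : ℝ)) = F * K := by
      rw [Finset.set_biInter_insert]
      funext ω
      simp only [F, K, Set.indicator, Set.mem_inter_iff, Pi.mul_apply]
      split_ifs <;> simp_all
    have hFK : Integrable (F * K) μ := hsplit ▸ hint _
      (Finset.measurableSet_biInter _ fun j hj => hm j _ (hf j hj))
    have hpull : μ[F * K | n i] =ᵐ[μ] μ[F | m'] * K :=
      (condExp_mul_of_stronglyMeasurable_right hKm hFK hF).trans
        ((h i _ hfi).mul Filter.EventuallyEq.rfl)
    have hFK' : Integrable (μ[F | m'] * K) μ := integrable_condExp.congr hpull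
    rw [hsplit, Finset.prod_insert hi]
    calc μ[F * K | m'] =ᵐ[μ] μ[μ[F * K | n i] | m'] :=
          (condExp_condExp_of_le (hm'n i) (hn i)).symm
      _ =ᵐ[μ] μ[μ[F | m'] * K | m'] := condExp_congr_ae hpull
      _ =ᵐ[μ] μ[F | m'] * μ[K | m'] :=
          condExp_mul_of_stronglyMeasurable_left stronglyMeasurable_condExp hFK' hK
      _ =ᵐ[μ] μ[F | m'] * ∏ j ∈ s, μ⟦f j | m'⟧ := Filter.EventuallyEq.rfl.mul (ih hfs)

end CondExp

section Shift

variable {M : Type*}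

/-- The σ-field generated by the coordinates in `S`. -/
@[reducible] def coordsField (S : Set M) : MeasurableSpace (M → unitInterval) :=
  ⨆ a ∈ S, coordField a

lemma coordField_le (a : M) :
    coordField a ≤ (inferInstance : MeasurableSpace (M → unitInterval)) :=
  measurable_iff_comap_le.mp (measurable_pi_apply a)

lemma coordsField_le (S : Set M) :
    coordsField S ≤ (inferInstance : MeasurableSpace (M → unitInterval)) :=
  iSup₂_le fun a _ => coordField_le a

lemma coordsField_mono {S S' : Set M} (h : S ⊆ S') : coordsField S ≤ coordsField S' :=
  biSup_mono h

lemma coordField_le_coordsField {S : Set M} {a : M} (ha : a ∈ S) :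
    coordField a ≤ coordsField S :=
  le_iSup₂_of_le a ha le_rfl

lemma coordsField_iUnion {ι : Sort*} (S : ι → Set M) :
    coordsField (⋃ i, S i) = ⨆ i, coordsField (S i) := by
  simp only [coordsField, Set.mem_iUnion, iSup_exists]
  exact iSup_comm

lemma tailField_le_coordsField {B : Set M} (hB : B.Finite) : tailField M ≤ coordsField Bᶜ := by
  refine (iInf_le _ hB.toFinset).trans (le_of_eq ?_)
  simp [coordsField]

lemma iInf_coordsField_compl_le_tailField {B : ℕ → Set M} (hB : Monotone B)
    (hU : ⋃ n, B n = Set.univ) : ⨅ n, coordsField (B n)ᶜ ≤ tailField M := by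
  refine le_iInf fun A => ?_
  obtain ⟨n, hn⟩ := hB.directed_le.exists_mem_subset_of_finset_subset_biUnion
    (s := A) (hU ▸ Set.subset_univ _)
  refine (iInf_le _ n).trans ?_
  exact biSup_mono fun a ha haA => ha (hn haA)

lemma measurable_shiftAct (g : Equiv.Perm M) : Measurable (shiftAct g) :=
  measurable_pi_lambda _ fun _ => measurable_pi_apply _

lemma comap_shiftAct_coordsField (g : Equiv.Perm M) (S : Set M) :
    (coordsField S).comap (shiftAct g) = coordsField (⇑g⁻¹ '' S) := by
  simp only [coordsField, coordField, MeasurableSpace.comap_iSup, MeasurableSpace.comap_comp,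
    iSup_image]
  rfl

/-- If all orbits of `G_a` on `M ∖ {a}` are infinite, then conditioning a `ξ_a`-event on all other
coordinates amounts to conditioning on the coordinates outside any finite set containing `a`. -/
theorem condExp_compl_singleton_ae_eq_condExp_compl [Countable M] {G : Subgroup (Equiv.Perm M)}
    {a : M} (horb : ∀ b : M, b ≠ a → {c : M | ∃ g ∈ G, g a = a ∧ g b = c}.Infinite)
    {μ : Measure (M → unitInterval)} [IsProbabilityMeasure μ]
    (hinv : ∀ g ∈ G, μ.map (shiftAct g) = μ) {s : Set (M → unitInterval)}
    (hs : MeasurableSet[coordField a] s) {B : Set M} (hB : B.Finite) (haB : a ∈ B) :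
    μ⟦s | coordsField {a}ᶜ⟧ =ᵐ[μ] μ⟦s | coordsField Bᶜ⟧ := by
  set f : (M → unitInterval) → ℝ := s.indicator fun _ => 1 with hf_def
  have hf : MemLp f 2 μ := (memLp_const 1).indicator (coordField_le a _ hs)
  have hf1 : ∀ᵐ ω ∂μ, |f ω| ≤ (1 : ℝ) := ae_of_all _ fun ω => by
    by_cases hω : ω ∈ s <;> simp [hf_def, hω]
  refine condExp_ae_eq_of_integral_sq_le (coordsField_mono (by simpa using haB))
    (coordsField_le _) hf ?_
  obtain ⟨e, he⟩ := exists_injective_nat M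
  let A : ℕ → Set M := fun n => {b | b ≠ a ∧ e b < n}
  have hAfin : ∀ n, (A n).Finite := fun n =>
    ((Set.finite_Iio n).preimage he.injOn).subset fun b hb => hb.2
  let ℱ : Filtration ℕ (inferInstance : MeasurableSpace (M → unitInterval)) :=
    { seq := fun n => coordsField (A n)
      mono' := fun i j hij => coordsField_mono fun b hb => ⟨hb.1, hb.2.trans_le hij⟩
      le' := fun n => coordsField_le _ }
  have hsup : ⨆ n, ℱ n = coordsField {a}ᶜ := by
    refine (coordsField_iUnion A).symm.trans (congrArg _ ?_)
    ext b
    simp only [A, Set.mem_iUnion, Set.mem_ofPred_eq, Set.mem_compl_iff, Set.mem_singleton_iff]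
    exact ⟨fun ⟨_, hb⟩ => hb.1, fun hb => ⟨e b + 1, hb, Nat.lt_succ_self _⟩⟩
  rw [← hsup]
  refine le_of_tendsto' (tendsto_integral_sq_condExp ℱ hf1) fun n => ?_
  let H : Subgroup (Equiv.Perm M) := G ⊓ MulAction.stabilizer (Equiv.Perm M) a
  obtain ⟨h, hh⟩ := MulAction.exists_smul_notMem_of_infinite_orbit (H := H) (hAfin n) hB
    fun b hb => (horb b hb.1).mono (by
      rintro c ⟨g, hg, hga, rfl⟩
      exact ⟨⟨g, hg, hga⟩, rfl⟩)
  obtain ⟨g, hgG, hga⟩ := h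
  have hga' : g a = a := hga
  have hT : MeasurePreserving (shiftAct g⁻¹) μ μ :=
    ⟨measurable_shiftAct _, hinv _ (G.inv_mem hgG)⟩
  have hfT : f ∘ shiftAct g⁻¹ = f := by
    obtain ⟨t, -, rfl⟩ := hs
    funext ω
    have hω : shiftAct g⁻¹ ω a = ω a := by simp [shiftAct, hga']
    change t.indicator (fun _ => (1 : ℝ)) (shiftAct g⁻¹ ω a) = t.indicator (fun _ => 1) (ω a)
    rw [hω]
  calc ∫ ω, μ[f | coordsField (A n)] ω ^ 2 ∂μ
      = ∫ ω, μ[f | coordsField (g '' A n)] ω ^ 2 ∂μ := by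
        rw [← hT.integral_sq_condExp_comap (coordsField_le _) (hf.integrable one_le_two) hfT,
          comap_shiftAct_coordsField, inv_inv]
    _ ≤ ∫ ω, μ[f | coordsField Bᶜ] ω ^ 2 ∂μ := by
        refine integral_sq_condExp_mono (coordsField_mono ?_) (coordsField_le _) hf
        rintro _ ⟨b, hb, rfl⟩
        exact hh b hb

theorem condExp_compl_singleton_ae_eq_condExp_tailField [Countable M]
    {G : Subgroup (Equiv.Perm M)} {a : M}
    (horb : ∀ b : M, b ≠ a → {c : M | ∃ g ∈ G, g a = a ∧ g b = c}.Infinite)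
    {μ : Measure (M → unitInterval)} [IsProbabilityMeasure μ]
    (hinv : ∀ g ∈ G, μ.map (shiftAct g) = μ) {s : Set (M → unitInterval)}
    (hs : MeasurableSet[coordField a] s) :
    μ⟦s | coordsField {a}ᶜ⟧ =ᵐ[μ] μ⟦s | tailField M⟧ := by
  obtain ⟨e, he⟩ := exists_injective_nat M
  let B : ℕ → Set M := fun n => insert a {b | e b < n}
  have hBfin : ∀ n, (B n).Finite := fun n =>
    ((Set.finite_Iio n).preimage he.injOn).insert a
  have hBmono : Monotone B := fun i j hij =>
    Set.insert_subset_insert fun b (hb : e b < i) => hb.trans_le hij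
  have hBU : ⋃ n, B n = Set.univ := Set.eq_univ_of_forall fun b =>
    Set.mem_iUnion.mpr ⟨e b + 1, Or.inr (Nat.lt_succ_self _)⟩
  have hmeas : AEStronglyMeasurable[tailField M] (μ⟦s | coordsField {a}ᶜ⟧) μ :=
    (aestronglyMeasurable_iInf_of_antitone
      (fun i j hij => coordsField_mono (Set.compl_subset_compl.mpr (hBmono hij)))
      fun n => stronglyMeasurable_condExp.aestronglyMeasurable.congr
        (condExp_compl_singleton_ae_eq_condExp_compl horb hinv hs (hBfin n)
          (Set.mem_insert a _)).symm).mono (iInf_coordsField_compl_le_tailField hBmono hBU)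
  exact (condExp_of_aestronglyMeasurable' (tailField_le M) hmeas integrable_condExp).symm.trans
    (condExp_condExp_of_le (tailField_le_coordsField (Set.finite_singleton a)) (coordsField_le _))

end Shift

/-- if for every `a ∈ M` all orbits of the stabilizer `G_a` on `M ∖ {a}` are
infinite, then for any `G`-invariant probability measure on `[0,1]^M`, the coordinate
σ-fields are conditionally independent given the tail σ-field `T₀`. -/
theorem coordFields_condIndep_given_tail
    {M : Type*} [Countable M] (G : Subgroup (Equiv.Perm M))
    (horb : ∀ a b : M, b ≠ a → {c : M | ∃ g ∈ G, g a = a ∧ g b = c}.Infinite)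
    (μ : Measure (M → unitInterval)) [IsProbabilityMeasure μ]
    (hinv : ∀ g ∈ G, μ.map (shiftAct g) = μ) :
    iCondIndep (tailField M) (tailField_le M) (fun a : M => coordField a) μ := by
  exact iCondIndep_of_condExp_ae_eq (n := fun a => coordsField {a}ᶜ) (tailField_le M)
    coordField_le (fun a => coordsField_le _)
    (fun a => tailField_le_coordsField (Set.finite_singleton a))
    (fun a b hba => coordField_le_coordsField hba)
    fun a s hs => condExp_compl_singleton_ae_eq_condExp_tailField (horb a) hinv hs
end

section
/- Let M be a countable set and G ≤ Sym(M) a permutation group with no algebraicity such that for every a ∈ M the stabilizer G_a is a maximal subgroup of G, and suppose G ↷ M has uniform non-algebraicity. Let Ω = [0,1]^M carry the product σ-algebra and the shift action, and let μ be a G-invariant, ergodic Borel probability measure on Ω. Then μ is a product measure: μ = ⊗_{a∈M} λ_a, where λ_a is the distribution of the coordinate ξ_a under μ. -/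
open MeasureTheory ProbabilityTheory

/-- `(b̄, a)` and `(b̄', a')` have the same type: every finite initial subtuple of the first
can be mapped to the corresponding subtuple of the second by an element of `G`. -/
def SameTypeExt {M : Type*} (G : Subgroup (Equiv.Perm M)) (b b' : ℕ → M) (a a' : M) :
    Prop :=
  ∀ n : ℕ, ∃ g ∈ G, (∀ i < n, g (b i) = b' i) ∧ g a = a'

/-- `G ↷ M` has uniform non-algebraicity: for every tuple `b̄` and every `a` not in `b̄`,
there are `b̄'` and `a' ≠ a''` with `tp(b̄'a') = tp(b̄'a'') = tp(b̄a)`. -/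
def UniformNonAlgebraicity {M : Type*} (G : Subgroup (Equiv.Perm M)) : Prop :=
  ∀ (b : ℕ → M) (a : M), (∀ i, b i ≠ a) →
    ∃ (b' : ℕ → M) (a' a'' : M), a' ≠ a'' ∧
      SameTypeExt G b b' a a' ∧ SameTypeExt G b b' a a''

theorem measurable_comp_index {M ι : Type*} (c : ι → M) :
    Measurable fun ω : M → unitInterval => ω ∘ c :=
  measurable_pi_lambda _ fun i => measurable_pi_apply (c i)

theorem measurePreserving_comp_perm {M : Type*} {G : Subgroup (Equiv.Perm M)}
    {μ : Measure (M → unitInterval)} (hinv : ∀ g ∈ G, μ.map (shiftAct g) = μ)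
    {g : Equiv.Perm M} (hg : g ∈ G) :
    MeasurePreserving (fun ω : M → unitInterval => ω ∘ g) μ μ := by
  refine ⟨measurable_comp_index g, ?_⟩
  have h := hinv g⁻¹ (inv_mem hg)
  have h2 : (shiftAct g⁻¹ : (M → unitInterval) → M → unitInterval) = fun ω => ω ∘ g := by
    funext ω a
    simp [shiftAct]
  rwa [h2] at h

/-- Families that have the same type index families of coordinates with the same law. -/
theorem map_comp_index_eq {M ι : Type*} {G : Subgroup (Equiv.Perm M)}
    {μ : Measure (M → unitInterval)} [IsProbabilityMeasure μ]
    (hinv : ∀ g ∈ G, μ.map (shiftAct g) = μ) {c c' : ι → M}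
    (h : ∀ I : Finset ι, ∃ g ∈ G, ∀ i ∈ I, g (c i) = c' i) :
    μ.map (fun ω : M → unitInterval => ω ∘ c) = μ.map (fun ω : M → unitInterval => ω ∘ c') := by
  have hp := fun d : ι → M => Measure.isProbabilityMeasure_map (μ := μ)
    (measurable_comp_index d).aemeasurable
  refine IsProjectiveLimit.unique
    (P := fun I : Finset ι => (μ.map fun ω : M → unitInterval => ω ∘ c').map I.restrict)
    (fun I => ?_) (fun I => rfl)
  obtain ⟨g, hg, hgI⟩ := h I
  have hm : Measurable (I.restrict : (ι → unitInterval) → _) := Finset.measurable_restrict I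
  rw [Measure.map_map hm (measurable_comp_index c)]
  beta_reduce
  rw [Measure.map_map hm (measurable_comp_index c')]
  conv_lhs => rw [← (measurePreserving_comp_perm hinv hg).map_eq]
  conv_rhs => rw [← (measurePreserving_comp_perm hinv (one_mem G)).map_eq]
  rw [Measure.map_map (hm.comp (measurable_comp_index c)) (measurable_comp_index _),
    Measure.map_map (hm.comp (measurable_comp_index c')) (measurable_comp_index _)]
  congr 1
  funext ω i
  simp [Finset.restrict, hgI i.1 i.2]

theorem SameTypeExt.map_prodMk_eq {M : Type*} {G : Subgroup (Equiv.Perm M)}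
    {μ : Measure (M → unitInterval)} [IsProbabilityMeasure μ]
    (hinv : ∀ g ∈ G, μ.map (shiftAct g) = μ) {b b' : ℕ → M} {a a' : M}
    (h : SameTypeExt G b b' a a') :
    μ.map (fun ω : M → unitInterval => (ω ∘ b, ω a)) =
      μ.map (fun ω : M → unitInterval => (ω ∘ b', ω a')) := by
  have hlaw : μ.map (fun ω : M → unitInterval => ω ∘ fun o : Option ℕ => o.elim a b) =
      μ.map (fun ω : M → unitInterval => ω ∘ fun o : Option ℕ => o.elim a' b') := by
    refine map_comp_index_eq hinv fun I => ?_
    obtain ⟨g, hg, hb, ha⟩ := h (I.eraseNone.sup id + 1)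
    refine ⟨g, hg, fun o ho => ?_⟩
    cases o with
    | none => exact ha
    | some i =>
      exact hb i (Nat.lt_succ_of_le (Finset.le_sup (f := id) (Finset.mem_eraseNone.2 ho)))
  have hm : Measurable fun x : Option ℕ → unitInterval => (fun i : ℕ => x (some i), x none) :=
    (measurable_pi_lambda _ fun i => measurable_pi_apply _).prodMk (measurable_pi_apply _)
  have := congrArg (Measure.map fun x : Option ℕ → unitInterval =>
    (fun i : ℕ => x (some i), x none)) hlaw
  rwa [Measure.map_map hm (measurable_comp_index _),
    Measure.map_map hm (measurable_comp_index _)] at this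

theorem comap_comp_index_le {M ι κ : Type*} {c : ι → M} {d : κ → M}
    (h : Set.range c ⊆ Set.range d) :
    MeasurableSpace.comap (fun ω : M → unitInterval => ω ∘ c) MeasurableSpace.pi ≤
      MeasurableSpace.comap (fun ω : M → unitInterval => ω ∘ d) MeasurableSpace.pi := by
  choose r hr using fun i => h ⟨i, rfl⟩
  have hc : (fun ω : M → unitInterval => ω ∘ c) =
      (fun x : κ → unitInterval => x ∘ r) ∘ fun ω => ω ∘ d := by
    funext ω i
    simp [hr]
  rw [hc, ← MeasurableSpace.comap_comp]
  exact MeasurableSpace.comap_mono (measurable_comp_index r).comap_le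

/-- Two nested conditional expectations with the same `L²` norm coincide. -/
theorem ae_eq_of_condExp_of_integral_sq_eq {Ω : Type*} {m₁ m₂ m₀ : MeasurableSpace Ω}
    {μ : Measure Ω} [IsProbabilityMeasure μ] (h₁₂ : m₁ ≤ m₂) (h₂ : m₂ ≤ m₀) {f F₁ F₂ : Ω → ℝ}
    (hF₁m : Measurable[m₁] F₁) (hF₂m : Measurable[m₂] F₂)
    (hF₁b : ∀ ω, ‖F₁ ω‖ ≤ 1) (hF₂b : ∀ ω, ‖F₂ ω‖ ≤ 1)
    (hF₁ : F₁ =ᵐ[μ] μ[f|m₁]) (hF₂ : F₂ =ᵐ[μ] μ[f|m₂])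
    (hsq : ∫ ω, F₁ ω * F₁ ω ∂μ = ∫ ω, F₂ ω * F₂ ω ∂μ) : F₁ =ᵐ[μ] F₂ := by
  have hm1 : Measurable F₁ := hF₁m.mono (h₁₂.trans h₂) le_rfl
  have hm2 : Measurable F₂ := hF₂m.mono h₂ le_rfl
  have hint : ∀ u v : Ω → ℝ, Measurable u → Measurable v → (∀ ω, ‖u ω‖ ≤ 1) →
      (∀ ω, ‖v ω‖ ≤ 1) → Integrable (fun ω => u ω * v ω) μ := fun u v hu hv hub hvb =>
    Integrable.of_bound (hu.mul hv).aestronglyMeasurable 1 (Filter.Eventually.of_forall fun ω => by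
      rw [norm_mul]
      exact mul_le_one₀ (hub ω) (norm_nonneg _) (hvb ω))
  have hi2 : Integrable F₂ μ :=
    Integrable.of_bound hm2.aestronglyMeasurable 1 (Filter.Eventually.of_forall hF₂b)
  have hcond : μ[F₂|m₁] =ᵐ[μ] F₁ :=
    (condExp_congr_ae hF₂).trans ((condExp_condExp_of_le h₁₂ h₂).trans hF₁.symm)
  have hcross : ∫ ω, F₁ ω * F₂ ω ∂μ = ∫ ω, F₁ ω * F₁ ω ∂μ := by
    have hpull : μ[F₁ * F₂|m₁] =ᵐ[μ] F₁ * μ[F₂|m₁] :=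
      condExp_stronglyMeasurable_mul_of_bound (h₁₂.trans h₂) hF₁m.stronglyMeasurable hi2 1
        (Filter.Eventually.of_forall hF₁b)
    calc ∫ ω, F₁ ω * F₂ ω ∂μ = ∫ ω, (μ[F₁ * F₂|m₁]) ω ∂μ :=
          (integral_condExp (h₁₂.trans h₂)).symm
      _ = ∫ ω, F₁ ω * F₁ ω ∂μ := by
          refine integral_congr_ae ?_
          filter_upwards [hpull, hcond] with ω h h'
          rw [h, Pi.mul_apply, h']
  have hdiff : ∫ ω, (F₁ ω - F₂ ω) ^ 2 ∂μ = 0 := by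
    have h11 := hint F₁ F₁ hm1 hm1 hF₁b hF₁b
    have h12 := hint F₁ F₂ hm1 hm2 hF₁b hF₂b
    have h22 := hint F₂ F₂ hm2 hm2 hF₂b hF₂b
    have : (fun ω => (F₁ ω - F₂ ω) ^ 2) =
        fun ω => (F₁ ω * F₁ ω - 2 * (F₁ ω * F₂ ω)) + F₂ ω * F₂ ω := by
      funext ω
      ring
    rw [this, integral_add (f := fun ω => F₁ ω * F₁ ω - 2 * (F₁ ω * F₂ ω)) (h11.sub (h12.const_mul 2)) h22, integral_sub h11 (h12.const_mul 2),
      integral_const_mul, hcross, ← hsq]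
    ring
  have hint_sq : Integrable (fun ω => (F₁ ω - F₂ ω) ^ 2) μ :=
    Integrable.of_bound ((hm1.sub hm2).pow_const 2).aestronglyMeasurable 4
      (Filter.Eventually.of_forall fun ω => by
        have h1 := abs_le.1 (hF₁b ω)
        have h2 := abs_le.1 (hF₂b ω)
        rw [Real.norm_eq_abs, abs_of_nonneg (sq_nonneg _)]
        nlinarith)
  have hzero := (integral_eq_zero_iff_of_nonneg (fun ω => sq_nonneg _) hint_sq).1 hdiff
  filter_upwards [hzero] with ω h
  exact sub_eq_zero.1 (pow_eq_zero_iff two_ne_zero |>.1 h)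

/-- A random variable whose a.e. class is fixed by every element of `G` is a.e. constant. -/
theorem ae_const_of_forall_comp_perm_ae_eq {M : Type*} {G : Subgroup (Equiv.Perm M)}
    {μ : Measure (M → unitInterval)} [IsProbabilityMeasure μ]
    (herg : ∀ E : Set (M → unitInterval), MeasurableSet E →
      (∀ g ∈ G, μ (symmDiff (shiftAct g ⁻¹' E) E) = 0) → μ E = 0 ∨ μ E = 1)
    {Z : (M → unitInterval) → ℝ} (hZ : Measurable Z)
    (hfix : ∀ g ∈ G, (fun ω => Z (ω ∘ g)) =ᵐ[μ] Z) : ∃ r : ℝ, Z =ᵐ[μ] fun _ => r := by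
  refine Filter.exists_eventuallyEq_const_of_forall_separating MeasurableSet fun U hU => ?_
  have hinvU : ∀ g ∈ G, μ (symmDiff (shiftAct g ⁻¹' (Z ⁻¹' U)) (Z ⁻¹' U)) = 0 := by
    intro g hg
    have h2 : (shiftAct g : (M → unitInterval) → M → unitInterval) =
        fun ω => ω ∘ (g⁻¹ : Equiv.Perm M) := rfl
    rw [measure_symmDiff_eq_zero_iff, h2]
    refine Filter.Eventually.set_eq ?_
    filter_upwards [hfix g⁻¹ (inv_mem hg)] with ω h
    simp only [Set.mem_preimage]
    rw [h]
  rcases herg (Z ⁻¹' U) (hZ hU) hinvU with h | h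
  · right
    exact measure_eq_zero_iff_ae_notMem.1 h
  · left
    exact (prob_compl_eq_zero_iff (hZ hU)).2 h

/-- Two points `a' ≠ a''` have distinct stabilizers if orbits of point stabilizers are infinite. -/
theorem stabilizer_ne_of_ne {M : Type*} {G : Subgroup (Equiv.Perm M)}
    (hnoalg : ∀ A : Set M, A.Finite → ∀ b ∉ A,
      {c : M | ∃ g ∈ G, (∀ a ∈ A, g a = a) ∧ g b = c}.Infinite)
    {a' a'' : M} (hne : a' ≠ a'') :
    MulAction.stabilizer G a' ≠ MulAction.stabilizer G a'' := by
  intro heq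
  refine hnoalg {a'} (Set.finite_singleton a') a'' (fun h => hne h.symm)
    ((Set.finite_singleton a'').subset ?_)
  rintro c ⟨g, hg, hga, rfl⟩
  have h : (⟨g, hg⟩ : G) ∈ MulAction.stabilizer G a' := hga a' rfl
  rw [heq] at h
  exact h

/-- Each coordinate is independent of all the other coordinates. -/
theorem measure_inter_eq_mul_of_uniform_nonalgebraicity
    {M : Type*} (G : Subgroup (Equiv.Perm M))
    (hnoalg : ∀ A : Set M, A.Finite → ∀ b ∉ A,
      {c : M | ∃ g ∈ G, (∀ a ∈ A, g a = a) ∧ g b = c}.Infinite)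
    (hmax : ∀ a : M, IsCoatom (MulAction.stabilizer G a))
    (huna : UniformNonAlgebraicity G)
    (μ : Measure (M → unitInterval)) [IsProbabilityMeasure μ]
    (hinv : ∀ g ∈ G, μ.map (shiftAct g) = μ)
    (herg : ∀ E : Set (M → unitInterval), MeasurableSet E →
      (∀ g ∈ G, μ (symmDiff (shiftAct g ⁻¹' E) E) = 0) → μ E = 0 ∨ μ E = 1)
    {a : M} {b : ℕ → M} (hb : Set.range b = {a}ᶜ) {s : Set unitInterval} (hs : MeasurableSet s)
    {B : Set (M → unitInterval)}
    (hB : MeasurableSet[MeasurableSpace.comap (fun ω : M → unitInterval => ω ∘ b)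
      MeasurableSpace.pi] B) :
    μ ((fun ω => ω a) ⁻¹' s ∩ B) = μ ((fun ω => ω a) ⁻¹' s) * μ B := by
  let φ : (ℕ → unitInterval) → ℝ := fun x =>
    (condDistrib (fun ω : M → unitInterval => ω a) (fun ω : M → unitInterval => ω ∘ b) μ x).real s
  have hφ : Measurable φ := (Kernel.measurable_coe _ hs).ennreal_toReal
  have hφb : ∀ x, ‖φ x‖ ≤ 1 := fun x => by
    rw [Real.norm_eq_abs, abs_of_nonneg measureReal_nonneg]
    exact measureReal_le_one
  have hφc : ∀ (c : ℕ → M), Measurable[MeasurableSpace.comap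
      (fun ω : M → unitInterval => ω ∘ c) MeasurableSpace.pi] fun ω : M → unitInterval =>
        φ (ω ∘ c) := fun c => hφ.comp (comap_measurable _)
  have hφcond : ∀ (b' : ℕ → M) (a' : M), SameTypeExt G b b' a a' →
      (fun ω : M → unitInterval => φ (ω ∘ b')) =ᵐ[μ]
        μ⟦(fun ω => ω a') ⁻¹' s | MeasurableSpace.comap
          (fun ω : M → unitInterval => ω ∘ b') MeasurableSpace.pi⟧ := fun b' a' h => by
    have hk : condDistrib (fun ω : M → unitInterval => ω a)
        (fun ω : M → unitInterval => ω ∘ b) μ =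
        condDistrib (fun ω : M → unitInterval => ω a') (fun ω : M → unitInterval => ω ∘ b') μ := by
      simp only [condDistrib_def, h.map_prodMk_eq hinv]
    simp only [φ, hk]
    exact condDistrib_ae_eq_condExp (measurable_comp_index b') (measurable_pi_apply a') hs
  have hsame : ∀ g ∈ G, SameTypeExt G b (g ∘ b) a (g a) := fun g hg n =>
    ⟨g, hg, fun _ _ => rfl, rfl⟩
  have hkey : ∀ (b' : ℕ → M) (a' : M), SameTypeExt G b b' a a' → ∀ g ∈ G, g a = a' →
      (fun ω : M → unitInterval => φ (ω ∘ b')) =ᵐ[μ] fun ω => φ (ω ∘ (g ∘ b)) := by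
    intro b' a' h g hg hga
    have hrange : Set.range b' ⊆ Set.range (g ∘ b) := by
      rintro _ ⟨i, rfl⟩
      obtain ⟨k, -, hk, hka⟩ := h (i + 1)
      rw [Set.range_comp, hb, Set.image_compl_eq g.bijective, Set.image_singleton, hga,
        ← hk i (Nat.lt_succ_self i), ← hka]
      have hbi : b i ∈ ({a}ᶜ : Set M) := hb ▸ ⟨i, rfl⟩
      simpa using hbi
    have hlaw : ∀ c : ℕ → M, ∀ a₁, SameTypeExt G b c a a₁ →
        ∫ ω, φ (ω ∘ c) * φ (ω ∘ c) ∂μ = ∫ ω, φ (ω ∘ b) * φ (ω ∘ b) ∂μ := by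
      intro c a₁ hc
      have hl : μ.map (fun ω : M → unitInterval => ω ∘ b) =
          μ.map (fun ω : M → unitInterval => ω ∘ c) := by
        refine map_comp_index_eq hinv fun I => ?_
        obtain ⟨k, hkG, hk, -⟩ := hc (I.sup id + 1)
        exact ⟨k, hkG, fun i hi => hk i (Nat.lt_succ_of_le (Finset.le_sup (f := id) hi))⟩
      have hi := fun d : ℕ → M => integral_map (μ := μ) (measurable_comp_index d).aemeasurable
        (f := fun x => φ x * φ x) (hφ.mul hφ).aestronglyMeasurable
      rw [← hi, ← hi, hl]
    have h2 := hφcond _ _ (hsame g hg)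
    rw [hga] at h2
    exact ae_eq_of_condExp_of_integral_sq_eq (comap_comp_index_le hrange)
      (measurable_comp_index _).comap_le (hφc _) (hφc _) (fun _ => hφb _) (fun _ => hφb _)
      (hφcond b' a' h) h2 ((hlaw _ _ h).trans (hlaw _ _ (hsame g hg)).symm)
  obtain ⟨b', a', a'', hne, h', h''⟩ := huna b a fun i hi => by
    have : b i ∈ ({a}ᶜ : Set M) := hb ▸ ⟨i, rfl⟩
    exact this hi
  let Z : (M → unitInterval) → ℝ := fun ω => φ (ω ∘ b')
  have hZ : Measurable Z := hφ.comp (measurable_comp_index b')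
  have hcomp : ∀ {g : Equiv.Perm M}, g ∈ G → ∀ {u v : (M → unitInterval) → ℝ}, u =ᵐ[μ] v →
      (fun ω => u (ω ∘ g)) =ᵐ[μ] fun ω => v (ω ∘ g) := fun hg _ _ huv =>
    (measurePreserving_comp_perm hinv hg).quasiMeasurePreserving.ae_eq_comp huv
  let H : Subgroup G :=
    { carrier := {g | (fun ω => Z (ω ∘ g.1)) =ᵐ[μ] Z}
      mul_mem' := fun {g k} hg hk => (hcomp g.2 hk).trans hg
      one_mem' := Filter.EventuallyEq.refl (ae μ) Z
      inv_mem' := fun {g} hg => by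
        have := hcomp (inv_mem g.2) hg
        refine Filter.EventuallyEq.symm (Filter.EventuallyEq.trans ?_ this)
        refine Filter.Eventually.of_forall fun ω => ?_
        congr 1
        funext x
        simp }
  have hstab : ∀ a₁, SameTypeExt G b b' a a₁ → MulAction.stabilizer G a₁ ≤ H := by
    intro a₁ h₁ k hk
    obtain ⟨g, hg, -, hga⟩ := h₁ 0
    have hka : k.1 a₁ = a₁ := hk
    have e := hkey b' a₁ h₁ g hg hga
    have e' := hkey b' a₁ h₁ (k.1 * g) (mul_mem k.2 hg) (by rw [Equiv.Perm.mul_apply, hga, hka])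
    exact (hcomp k.2 e).trans e'.symm
  have hH : H = ⊤ := top_le_iff.1 <|
    ((hmax a').sup_eq_top_of_ne (hmax a'') (stabilizer_ne_of_ne hnoalg hne)).symm.le.trans
      (sup_le (hstab a' h') (hstab a'' h''))
  obtain ⟨r, hr⟩ := ae_const_of_forall_comp_perm_ae_eq herg hZ fun g hg => by
    have : (⟨g, hg⟩ : G) ∈ H := hH ▸ Subgroup.mem_top _
    exact this
  have hconst : (fun ω : M → unitInterval => φ (ω ∘ b)) =ᵐ[μ] fun _ => r := by
    obtain ⟨g, hg, -, hga⟩ := h' 0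
    have e := hcomp (inv_mem hg) ((hkey b' a' h' g hg hga).symm.trans hr)
    refine Filter.EventuallyEq.trans (Filter.Eventually.of_forall fun ω => ?_) e
    dsimp only
    congr 1
    funext x
    simp
  have hcond := (hφcond b a fun n => ⟨1, one_mem G, fun _ _ => rfl, rfl⟩).symm.trans hconst
  have hle := (measurable_comp_index (M := M) b).comap_le
  have hsm : MeasurableSet ((fun ω : M → unitInterval => ω a) ⁻¹' s) := measurable_pi_apply a hs
  have hval : ∀ C, MeasurableSet[MeasurableSpace.comap (fun ω : M → unitInterval => ω ∘ b)
      MeasurableSpace.pi] C → μ.real ((fun ω => ω a) ⁻¹' s ∩ C) = μ.real C * r := by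
    intro C hC
    have h1 := setIntegral_condExp (μ := μ) hle
      ((integrable_const (1 : ℝ)).indicator hsm) hC
    rw [integral_indicator_const _ hsm, measureReal_restrict_apply hsm,
      setIntegral_congr_ae (g := fun _ => r) (hle C hC) (hcond.mono fun _ h _ => h)] at h1
    simpa using h1.symm
  have hr1 := hval _ MeasurableSet.univ
  rw [Set.inter_univ, probReal_univ, one_mul] at hr1
  have h := hval B hB
  rw [← hr1, mul_comm] at h
  rw [← ENNReal.toReal_eq_toReal_iff' (measure_ne_top _ _)
    (ENNReal.mul_ne_top (measure_ne_top _ _) (measure_ne_top _ _)), ENNReal.toReal_mul]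
  exact h

/-- a de Finetti theorem. If `G ≤ Sym(M)` has no algebraicity, all point
stabilizers are maximal subgroups, and `G ↷ M` has uniform non-algebraicity, then every
`G`-invariant ergodic probability measure on `[0,1]^M` is the product of the marginal
distributions of the coordinates. -/
theorem ergodic_invariant_measure_eq_product_of_uniform_nonalgebraicity
    {M : Type*} [Countable M] (G : Subgroup (Equiv.Perm M))
    (hnoalg : ∀ A : Set M, A.Finite → ∀ b ∉ A,
      {c : M | ∃ g ∈ G, (∀ a ∈ A, g a = a) ∧ g b = c}.Infinite)
    (hmax : ∀ a : M, IsCoatom (MulAction.stabilizer G a))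
    (huna : UniformNonAlgebraicity G)
    (μ : Measure (M → unitInterval)) [IsProbabilityMeasure μ]
    (hinv : ∀ g ∈ G, μ.map (shiftAct g) = μ)
    (herg : ∀ E : Set (M → unitInterval), MeasurableSet E →
      (∀ g ∈ G, μ (symmDiff (shiftAct g ⁻¹' E) E) = 0) → μ E = 0 ∨ μ E = 1) :
    ∀ (S : Finset M) (s : M → Set unitInterval), (∀ a ∈ S, MeasurableSet (s a)) →
      μ {ω : M → unitInterval | ∀ a ∈ S, ω a ∈ s a}
        = ∏ a ∈ S, (μ.map (fun ω : M → unitInterval => ω a)) (s a) := by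
  classical
  intro S s hs
  induction S using Finset.induction_on with
  | empty => simp
  | insert a S ha ih =>
    have hother : Nonempty ({a}ᶜ : Set M) := by
      obtain ⟨c, -, hc⟩ := (hnoalg ∅ Set.finite_empty a (Set.notMem_empty a)).exists_notMem_finite
        (Set.finite_singleton a)
      exact ⟨c, hc⟩
    obtain ⟨e, he⟩ := exists_surjective_nat ({a}ᶜ : Set M)
    have hb : Set.range (fun n => (e n : M)) = {a}ᶜ := by
      rw [show (fun n => (e n : M)) = Subtype.val ∘ e from rfl, he.range_comp, Subtype.range_coe]
    have hB : MeasurableSet[MeasurableSpace.comap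
        (fun ω : M → unitInterval => ω ∘ fun n => (e n : M)) MeasurableSpace.pi]
        {ω : M → unitInterval | ∀ c ∈ S, ω c ∈ s c} := by
      refine ⟨{x | ∀ n, (e n : M) ∈ S → x n ∈ s (e n)}, ?_, ?_⟩
      · simp only [Set.ofPred_forall]
        exact MeasurableSet.iInter fun n => MeasurableSet.iInter fun hn =>
          measurable_pi_apply n (hs _ (Finset.mem_insert_of_mem hn))
      · ext ω
        refine ⟨fun h c hc => ?_, fun h n hn => h _ hn⟩
        obtain ⟨n, hn⟩ := he ⟨c, fun hca => ha (hca ▸ hc)⟩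
        have := h n (by rwa [hn])
        simpa [hn] using this
    have hsa := hs a (Finset.mem_insert_self a S)
    have h := measure_inter_eq_mul_of_uniform_nonalgebraicity G hnoalg hmax huna μ hinv herg hb
      hsa hB
    rw [Finset.prod_insert ha, ← ih fun c hc => hs c (Finset.mem_insert_of_mem hc),
      Measure.map_apply (measurable_pi_apply a) hsa, ← h]
    congr 1
    ext ω
    simp
end
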